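/- arXiv:1807.11409 — 3 statements merged into one kernel-verified Lean document; each statement's English description precedes it below -/
import Mathlib

section
/- Let p be a prime with p > 3 and let M be a 3×3 upper unitriangular matrix over ZMod p (i.e., M is upper triangular with all diagonal entries equal to 1). Then the sum Id + M + M^2 + ⋯ + M^(p−1) is the zero matrix. -/
/-- In characteristic `p`, the geometric sum `1 + x + ⋯ + x ^ (p - 1)` equals
`(x - 1) ^ (p - 1)`. -/
theorem geom_sum_eq_sub_one_pow_of_prime {p : ℕ} [Fact p.Prime] {A : Type*} [Ring A]
    [Algebra (ZMod p) A] (x : A) :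
    ∑ k ∈ Finset.range p, x ^ k = (x - 1) ^ (p - 1) := by
  have key : ∑ k ∈ Finset.range p, (Polynomial.X : Polynomial (ZMod p)) ^ k =
      (Polynomial.X - 1) ^ (p - 1) := by
    have hne : (Polynomial.X - 1 : Polynomial (ZMod p)) ≠ 0 := by
      simpa using Polynomial.X_sub_C_ne_zero (1 : ZMod p)
    apply mul_right_cancel₀ hne
    rw [geom_sum_mul, pow_sub_one_mul (Fact.out : p.Prime).ne_zero, sub_pow_char, one_pow]
  simpa using congrArg (Polynomial.aeval x) key

/-- A strictly upper triangular `3 × 3` matrix has zero cube. -/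
theorem Matrix.pow_three_eq_zero_of_strictly_upper {R : Type*} [CommRing R]
    (N : Matrix (Fin 3) (Fin 3) R) (hN : ∀ i j, j ≤ i → N i j = 0) : N ^ 3 = 0 := by
  have h00 := hN 0 0 (by decide)
  have h10 := hN 1 0 (by decide)
  have h11 := hN 1 1 (by decide)
  have h20 := hN 2 0 (by decide)
  have h21 := hN 2 1 (by decide)
  have h22 := hN 2 2 (by decide)
  ext i j
  fin_cases i <;> fin_cases j <;>
    simp [pow_succ, Matrix.mul_apply, Fin.sum_univ_three, h00, h10, h11, h20, h21, h22]

/-- For a prime `p > 3` and a `3 × 3` upper unitriangular matrix `M` over `ZMod p`,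
`Id + M + M^2 + ⋯ + M^(p-1) = 0`. -/
theorem stmt_15 (p : ℕ) (hp : p.Prime) (hgt : 3 < p)
    (M : Matrix (Fin 3) (Fin 3) (ZMod p))
    (hdiag : ∀ i, M i i = 1) (hlower : ∀ i j, j < i → M i j = 0) :
    ∑ k ∈ Finset.range p, M ^ k = 0 := by
  have : Fact p.Prime := ⟨hp⟩
  rw [geom_sum_eq_sub_one_pow_of_prime]
  refine pow_eq_zero_of_le (show 3 ≤ p - 1 by omega)
    (Matrix.pow_three_eq_zero_of_strictly_upper _ fun i j hij => ?_)
  rcases hij.eq_or_lt with rfl | hlt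
  · simp [hdiag]
  · simp [hlower i j hlt, Matrix.one_apply_ne hlt.ne']
end

section
/- Let p be an odd prime. The automorphism group of (ZMod (p^2)) × (ZMod p) has order p^3·(p−1)^2. -/
namespace ZMod

/-- The embedding of `ZMod p` into `ZMod (p ^ 2)` given by multiplication by `p`. -/
def mulEmbed (p : ℕ) : ZMod p →+ ZMod (p ^ 2) :=
  ZMod.lift p ⟨(AddMonoidHom.mulLeft (p : ZMod (p ^ 2))).comp (Int.castAddHom _), by
    have h : (p : ZMod (p ^ 2)) ^ 2 = 0 := by exact_mod_cast ZMod.natCast_self (p ^ 2)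
    simpa [← sq] using h⟩

/-- The reduction map from `ZMod (p ^ 2)` to `ZMod p`. -/
def reduceSq (p : ℕ) : ZMod (p ^ 2) →+* ZMod p :=
  ZMod.castHom (dvd_pow_self p two_ne_zero) (ZMod p)

variable {p : ℕ}

lemma mulEmbed_intCast (k : ℤ) : mulEmbed p k = p * k := by
  simp [mulEmbed]

lemma mulEmbed_reduceSq (x : ZMod (p ^ 2)) : mulEmbed p (reduceSq p x) = p * x := by
  obtain ⟨k, rfl⟩ := ZMod.intCast_surjective x
  rw [map_intCast, mulEmbed_intCast]

lemma reduceSq_mulEmbed (y : ZMod p) : reduceSq p (mulEmbed p y) = 0 := by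
  obtain ⟨k, rfl⟩ := ZMod.intCast_surjective y
  simp [mulEmbed_intCast]

lemma mulEmbed_injective (hp : p ≠ 0) : Function.Injective (mulEmbed p) := by
  rw [injective_iff_map_eq_zero]
  intro y hy
  obtain ⟨k, rfl⟩ := ZMod.intCast_surjective y
  rw [mulEmbed_intCast] at hy
  have h : ((p * k : ℤ) : ZMod (p ^ 2)) = 0 := by push_cast; exact hy
  rw [ZMod.intCast_zmod_eq_zero_iff_dvd] at h ⊢
  push_cast at h
  rw [sq] at h
  exact Int.dvd_of_mul_dvd_mul_left (by exact_mod_cast hp) h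

lemma exists_mulEmbed_eq (hp : p ≠ 0) {x : ZMod (p ^ 2)} (hx : p * x = 0) :
    ∃ y, mulEmbed p y = x := by
  rw [← mulEmbed_reduceSq] at hx
  have h := mulEmbed_injective hp (hx.trans (map_zero _).symm)
  obtain ⟨k, rfl⟩ := ZMod.intCast_surjective x
  rw [map_intCast, ZMod.intCast_zmod_eq_zero_iff_dvd] at h
  obtain ⟨m, rfl⟩ := h
  exact ⟨m, by simp [mulEmbed_intCast]⟩

lemma isUnit_of_reduceSq_ne_zero (hp : p.Prime) {x : ZMod (p ^ 2)} (hx : reduceSq p x ≠ 0) :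
    IsUnit x := by
  have : NeZero p := ⟨hp.ne_zero⟩
  obtain ⟨k, rfl⟩ := ZMod.natCast_zmod_surjective x
  rw [map_natCast, Ne, ZMod.natCast_eq_zero_iff] at hx
  rw [ZMod.isUnit_iff_coprime]
  exact (((Nat.Prime.coprime_iff_not_dvd hp).2 hx).symm).pow_right 2

/-- The endomorphism of `ZMod (p ^ 2) × ZMod p` with matrix entries `a`, `b`, `c`, `d`. -/
def sqProdHom (a : ZMod (p ^ 2)) (b c d : ZMod p) :
    ZMod (p ^ 2) × ZMod p →+ ZMod (p ^ 2) × ZMod p where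
  toFun v := (a * v.1 + mulEmbed p (c * v.2), b * reduceSq p v.1 + d * v.2)
  map_zero' := by simp
  map_add' v w := by
    ext
    · simp only [Prod.fst_add, Prod.snd_add, mul_add, map_add]; ring
    · simp only [Prod.fst_add, Prod.snd_add, mul_add, map_add]; ring

lemma sqProdHom_apply (a : ZMod (p ^ 2)) (b c d : ZMod p) (v : ZMod (p ^ 2) × ZMod p) :
    sqProdHom a b c d v = (a * v.1 + mulEmbed p (c * v.2), b * reduceSq p v.1 + d * v.2) :=
  rfl

lemma sqProdHom_bijective [NeZero p] (a : (ZMod (p ^ 2))ˣ) (b c : ZMod p) (d : (ZMod p)ˣ) :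
    Function.Bijective (sqProdHom (a : ZMod (p ^ 2)) b c d) := by
  rw [← Finite.injective_iff_bijective, injective_iff_map_eq_zero]
  rintro ⟨x, y⟩ h
  simp only [sqProdHom_apply, Prod.mk_eq_zero] at h
  obtain ⟨h₁, h₂⟩ := h
  have hx : reduceSq p x = 0 := by
    have h := congrArg (reduceSq p) h₁
    rw [map_add, map_mul, reduceSq_mulEmbed, add_zero, map_zero] at h
    exact (a.isUnit.map (reduceSq p)).mul_right_eq_zero.1 h
  have hy : y = 0 := by
    rw [hx, mul_zero, zero_add] at h₂
    exact d.isUnit.mul_right_eq_zero.1 h₂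
  subst hy
  rw [mul_zero, map_zero, add_zero] at h₁
  exact Prod.ext (a.isUnit.mul_right_eq_zero.1 h₁) rfl

lemma sqProd_hom_ext {A : Type*} [AddMonoid A] {f g : ZMod (p ^ 2) × ZMod p →+ A}
    [NeZero p] (h₁ : f (1, 0) = g (1, 0)) (h₂ : f (0, 1) = g (0, 1)) : f = g := by
  ext ⟨x, y⟩
  have h : ((x, y) : ZMod (p ^ 2) × ZMod p) = x.val • (1, 0) + y.val • (0, 1) := by
    ext <;> simp
  rw [h, map_add, map_add, map_nsmul, map_nsmul, map_nsmul, map_nsmul, h₁, h₂]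

/-- The automorphism of `ZMod (p ^ 2) × ZMod p` with given matrix entries. -/
noncomputable def sqProdAut [NeZero p]
    (m : ((ZMod (p ^ 2))ˣ × ZMod p) × (ZMod p × (ZMod p)ˣ)) :
    AddAut (ZMod (p ^ 2) × ZMod p) :=
  AddEquiv.ofBijective _ (sqProdHom_bijective m.1.1 m.1.2 m.2.1 m.2.2)

lemma sqProdAut_apply [NeZero p] (m : ((ZMod (p ^ 2))ˣ × ZMod p) × (ZMod p × (ZMod p)ˣ))
    (v : ZMod (p ^ 2) × ZMod p) :
    sqProdAut m v = sqProdHom (m.1.1 : ZMod (p ^ 2)) m.1.2 m.2.1 m.2.2 v :=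
  rfl

lemma sqProdAut_injective [NeZero p] : Function.Injective (sqProdAut (p := p)) := by
  rintro ⟨⟨a, b⟩, c, d⟩ ⟨⟨a', b'⟩, c', d'⟩ h
  have h₁ := DFunLike.congr_fun h (1, 0)
  have h₂ := DFunLike.congr_fun h (0, 1)
  simp only [sqProdAut_apply, sqProdHom_apply, Prod.mk.injEq, mul_one, mul_zero, map_zero,
    map_one, add_zero, zero_add, Units.val_inj] at h₁ h₂
  rw [h₁.1, h₁.2, mulEmbed_injective (NeZero.ne p) h₂.1, h₂.2]

lemma sqProdAut_surjective [NeZero p] (hp : p.Prime) :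
    Function.Surjective (sqProdAut (p := p)) := by
  have : Fact p.Prime := ⟨hp⟩
  intro f
  obtain ⟨⟨a, b⟩, h₁⟩ : ∃ v, f (1, 0) = v := ⟨_, rfl⟩
  obtain ⟨⟨e, d⟩, h₂⟩ : ∃ v, f (0, 1) = v := ⟨_, rfl⟩
  have he : p * e = 0 := by
    have h := map_nsmul f p (0, 1)
    rw [h₂] at h
    have h0 : f (0, 0) = 0 := map_zero f
    simpa [h0] using (congrArg Prod.fst h).symm
  obtain ⟨c, rfl⟩ := exists_mulEmbed_eq hp.ne_zero he
  have hf : (f : ZMod (p ^ 2) × ZMod p →+ _) = sqProdHom a b c d :=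
    sqProd_hom_ext (by simp [h₁, sqProdHom_apply]) (by simp [h₂, sqProdHom_apply])
  have hf' (v) : f v = sqProdHom a b c d v := DFunLike.congr_fun hf v
  have ha : IsUnit a := by
    refine isUnit_of_reduceSq_ne_zero hp fun ha ↦ ?_
    have h : f (mulEmbed p 1, 0) = f 0 := by
      have h1 : mulEmbed p 1 = p := by simpa using mulEmbed_intCast (p := p) 1
      rw [map_zero, hf', sqProdHom_apply, reduceSq_mulEmbed, h1, mul_comm a,
        ← mulEmbed_reduceSq, ha]
      simp
    have h' := congrArg Prod.fst (f.injective h)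
    exact one_ne_zero (mulEmbed_injective hp.ne_zero (h'.trans (map_zero _).symm))
  have hd : d ≠ 0 := by
    rintro rfl
    obtain ⟨u, rfl⟩ := ha
    obtain ⟨k, rfl⟩ := ZMod.intCast_surjective c
    have h : f (↑u⁻¹ * mulEmbed p k, 0) = f (0, 1) := by
      simp [hf', sqProdHom_apply, reduceSq_mulEmbed]
    exact zero_ne_one (congrArg Prod.snd (f.injective h))
  obtain ⟨u, rfl⟩ := ha
  refine ⟨((u, b), c, Units.mk0 d hd), ?_⟩
  ext1 v
  exact (hf' v).symm

end ZMod

/-- For an odd prime `p`, `|Aut(ZMod (p^2) × ZMod p)| = p^3 * (p-1)^2`. -/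
theorem stmt_17 (p : ℕ) (hp : p.Prime) (hodd : Odd p) :
    Nat.card (AddAut (ZMod (p ^ 2) × ZMod p)) = p ^ 3 * (p - 1) ^ 2 := by
  have : NeZero p := ⟨hp.ne_zero⟩
  rw [← Nat.card_eq_of_bijective _ ⟨ZMod.sqProdAut_injective, ZMod.sqProdAut_surjective hp⟩]
  simp only [Nat.card_prod, Nat.card_zmod]
  rw [Nat.card_eq_fintype_card, Nat.card_eq_fintype_card, ZMod.card_units_eq_totient,
    ZMod.card_units_eq_totient, Nat.totient_prime_pow hp two_pos, Nat.totient_prime hp]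
  ring
end

section
/- Let p be an odd prime. The automorphism group of the Heisenberg group H_p has order p^3·(p−1)^2·(p+1); more precisely, the natural homomorphism from Aut(H_p) to Aut(H_p / Z(H_p)) ≅ GL(2, ZMod p) induced by the quotient by the center is surjective with kernel of order p^2. -/
/-- The Heisenberg group of order `p^3`: triples `(a, b, c)` corresponding to the
upper unitriangular matrix `![![1, a, b], ![0, 1, c], ![0, 0, 1]]` over `ZMod p`. -/
@[ext]
structure Heisenberg (p : ℕ) where
  a : ZMod p
  b : ZMod p
  c : ZMod p

namespace Heisenberg

variable {p : ℕ}

instance : Mul (Heisenberg p) :=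
  ⟨fun x y => ⟨x.a + y.a, x.b + y.b + x.a * y.c, x.c + y.c⟩⟩

instance : One (Heisenberg p) := ⟨⟨0, 0, 0⟩⟩

instance : Inv (Heisenberg p) := ⟨fun x => ⟨-x.a, -x.b + x.a * x.c, -x.c⟩⟩

@[simp] lemma mul_a (x y : Heisenberg p) : (x * y).a = x.a + y.a := rfl
@[simp] lemma mul_b (x y : Heisenberg p) : (x * y).b = x.b + y.b + x.a * y.c := rfl
@[simp] lemma mul_c (x y : Heisenberg p) : (x * y).c = x.c + y.c := rfl
@[simp] lemma one_a : (1 : Heisenberg p).a = 0 := rfl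
@[simp] lemma one_b : (1 : Heisenberg p).b = 0 := rfl
@[simp] lemma one_c : (1 : Heisenberg p).c = 0 := rfl
@[simp] lemma inv_a (x : Heisenberg p) : x⁻¹.a = -x.a := rfl
@[simp] lemma inv_b (x : Heisenberg p) : x⁻¹.b = -x.b + x.a * x.c := rfl
@[simp] lemma inv_c (x : Heisenberg p) : x⁻¹.c = -x.c := rfl

instance : Group (Heisenberg p) where
  mul_assoc x y z := by ext <;> simp <;> ring
  one_mul x := by ext <;> simp
  mul_one x := by ext <;> simp
  inv_mul_cancel x := by ext <;> simp <;> ring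

end Heisenberg

namespace Heisenberg

variable (p : ℕ)

/-- The abelianization map `(a, b, c) ↦ (a, c)`, valued in `(ZMod p)²` written multiplicatively. -/
def toVec : Heisenberg p →* Multiplicative (Fin 2 → ZMod p) where
  toFun x := Multiplicative.ofAdd ![x.a, x.c]
  map_one' := by
    rw [ofAdd_eq_one]
    ext i; fin_cases i <;> rfl
  map_mul' x y := by
    rw [← ofAdd_add]
    congr 1
    ext i; fin_cases i <;> rfl

variable {p}

lemma toVec_apply (x : Heisenberg p) : toVec p x = Multiplicative.ofAdd ![x.a, x.c] := rfl

lemma toVec_surjective : Function.Surjective (toVec p) := fun v =>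
  ⟨⟨v.toAdd 0, 0, v.toAdd 1⟩, by
    apply Multiplicative.toAdd.injective
    ext i; fin_cases i <;> rfl⟩

lemma mem_center_iff {x : Heisenberg p} :
    x ∈ Subgroup.center (Heisenberg p) ↔ x.a = 0 ∧ x.c = 0 := by
  rw [Subgroup.mem_center_iff]
  constructor
  · intro h
    have h₁ := congrArg Heisenberg.b (h ⟨1, 0, 0⟩)
    have h₂ := congrArg Heisenberg.b (h ⟨0, 0, 1⟩)
    simp only [mul_b] at h₁ h₂
    constructor
    · linear_combination -h₂
    · linear_combination h₁
  · rintro ⟨ha, hc⟩ g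
    ext <;> simp [ha, hc, add_comm]

lemma center_eq_ker_toVec : Subgroup.center (Heisenberg p) = (toVec p).ker := by
  ext x
  rw [mem_center_iff, MonoidHom.mem_ker, toVec_apply, ofAdd_eq_one]
  simp

lemma mk_eq_mk_iff {x y : Heisenberg p} :
    (QuotientGroup.mk x : Heisenberg p ⧸ Subgroup.center (Heisenberg p)) = QuotientGroup.mk y ↔
      x.a = y.a ∧ x.c = y.c := by
  rw [QuotientGroup.eq, mem_center_iff, mul_a, mul_c, inv_a, inv_c, neg_add_eq_zero,
    neg_add_eq_zero]

variable (p) in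
/-- The quotient of the Heisenberg group by its center is `(ZMod p)²`. -/
noncomputable def quotientCenterEquiv :
    Heisenberg p ⧸ Subgroup.center (Heisenberg p) ≃* Multiplicative (Fin 2 → ZMod p) :=
  QuotientGroup.liftEquiv _ toVec_surjective center_eq_ker_toVec

variable (p) in
/-- Additive automorphisms of a `ZMod p`-module are the linear ones. -/
def addAutEquivLinearEquiv (V : Type*) [AddCommGroup V] [Module (ZMod p) V] :
    AddAut V ≃ (V ≃ₗ[ZMod p] V) where
  toFun f := { f with map_smul' := ZMod.map_smul f }
  invFun f := f.toAddEquiv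
  left_inv _ := rfl
  right_inv _ := rfl

variable (p) in
/-- Automorphisms of the quotient by the center, as invertible matrices. -/
noncomputable def quotientAutEquivGL :
    MulAut (Heisenberg p ⧸ Subgroup.center (Heisenberg p)) ≃ GL (Fin 2) (ZMod p) :=
  ((MulAut.congr (quotientCenterEquiv p)).trans
    (MulAutMultiplicative (Fin 2 → ZMod p))).toEquiv.trans <|
  Multiplicative.toAdd.trans <|
  (addAutEquivLinearEquiv p (Fin 2 → ZMod p)).trans
    (Matrix.GeneralLinearGroup.toLin.trans
      (LinearMap.GeneralLinearGroup.generalLinearEquiv _ _)).toEquiv.symm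

lemma quotientAutEquivGL_symm_apply (M : GL (Fin 2) (ZMod p)) (x : Heisenberg p) :
    quotientCenterEquiv p ((quotientAutEquivGL p).symm M (QuotientGroup.mk x)) =
      Multiplicative.ofAdd (M.val.mulVec ![x.a, x.c]) := by
  change quotientCenterEquiv p ((quotientCenterEquiv p).symm _) = _
  rw [MulEquiv.apply_symm_apply]
  rfl

/-- The homomorphism from automorphisms of the Heisenberg group to automorphisms of its quotient
by the center. -/
def quotientAut (p : ℕ) :
    MulAut (Heisenberg p) →* MulAut (Heisenberg p ⧸ Subgroup.center (Heisenberg p)) where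
  toFun φ := QuotientGroup.congr _ _ φ
    (Subgroup.characteristic_iff_map_eq.1 inferInstance φ)
  map_one' := by
    ext x
    induction x using QuotientGroup.induction_on with | H x => rfl
  map_mul' φ ψ := by
    ext x
    induction x using QuotientGroup.induction_on with | H x => rfl

@[simp]
lemma quotientAut_mk (φ : MulAut (Heisenberg p)) (x : Heisenberg p) :
    quotientAut p φ (QuotientGroup.mk x) = QuotientGroup.mk (φ x) := rfl

lemma mem_ker_quotientAut {φ : MulAut (Heisenberg p)} :
    φ ∈ (quotientAut p).ker ↔ ∀ x, (φ x).a = x.a ∧ (φ x).c = x.c := by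
  rw [MonoidHom.mem_ker]
  constructor
  · intro h x
    rw [← mk_eq_mk_iff, ← quotientAut_mk, h, MulAut.one_apply]
  · intro h
    ext x
    induction x using QuotientGroup.induction_on with
    | H x => exact mk_eq_mk_iff.2 (h x)

lemma mk_a_pow (n : ℕ) : (⟨1, 0, 0⟩ : Heisenberg p) ^ n = ⟨n, 0, 0⟩ := by
  induction n with
  | zero => ext <;> simp
  | succ n ih => rw [pow_succ, ih]; ext <;> simp

lemma mk_b_pow (n : ℕ) : (⟨0, 1, 0⟩ : Heisenberg p) ^ n = ⟨0, n, 0⟩ := by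
  induction n with
  | zero => ext <;> simp
  | succ n ih => rw [pow_succ, ih]; ext <;> simp

lemma mk_c_pow (n : ℕ) : (⟨0, 0, 1⟩ : Heisenberg p) ^ n = ⟨0, 0, n⟩ := by
  induction n with
  | zero => ext <;> simp
  | succ n ih => rw [pow_succ, ih]; ext <;> simp

/-- The Heisenberg group is generated by `(1, 0, 0)` and `(0, 0, 1)`. -/
lemma eq_top_of_mem [NeZero p] (S : Subgroup (Heisenberg p)) (ha : ⟨1, 0, 0⟩ ∈ S)
    (hc : ⟨0, 0, 1⟩ ∈ S) : S = ⊤ := by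
  have hb : (⟨0, 1, 0⟩ : Heisenberg p) ∈ S := by
    have h : (⟨0, 1, 0⟩ : Heisenberg p) =
        ⟨1, 0, 0⟩ * ⟨0, 0, 1⟩ * ⟨1, 0, 0⟩⁻¹ * ⟨0, 0, 1⟩⁻¹ := by
      ext <;> simp
    rw [h]
    exact S.mul_mem (S.mul_mem (S.mul_mem ha hc) (S.inv_mem ha)) (S.inv_mem hc)
  rw [eq_top_iff]
  rintro ⟨a, b, c⟩ -
  have h : (⟨a, b, c⟩ : Heisenberg p) =
      ⟨0, 0, 1⟩ ^ c.val * ⟨1, 0, 0⟩ ^ a.val * ⟨0, 1, 0⟩ ^ b.val := by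
    rw [mk_a_pow, mk_b_pow, mk_c_pow]
    ext <;> simp
  rw [h]
  exact S.mul_mem (S.mul_mem (S.pow_mem hc _) (S.pow_mem ha _)) (S.pow_mem hb _)

lemma mulAut_ext [NeZero p] {φ ψ : MulAut (Heisenberg p)} (ha : φ ⟨1, 0, 0⟩ = ψ ⟨1, 0, 0⟩)
    (hc : φ ⟨0, 0, 1⟩ = ψ ⟨0, 0, 1⟩) : φ = ψ := by
  have h := eq_top_of_mem (φ.toMonoidHom.eqLocus ψ.toMonoidHom) ha hc
  ext1 x
  exact (h ▸ Subgroup.mem_top x : x ∈ φ.toMonoidHom.eqLocus ψ.toMonoidHom)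

/-- The automorphism `(a, b, c) ↦ (a, b + s a + t c, c)`. -/
def centralAut (s t : ZMod p) : MulAut (Heisenberg p) where
  toFun x := ⟨x.a, x.b + s * x.a + t * x.c, x.c⟩
  invFun x := ⟨x.a, x.b - s * x.a - t * x.c, x.c⟩
  left_inv x := by ext <;> simp; ring
  right_inv x := by ext <;> simp; ring
  map_mul' x y := by ext <;> simp; ring

lemma centralAut_apply (s t : ZMod p) (x : Heisenberg p) :
    centralAut s t x = ⟨x.a, x.b + s * x.a + t * x.c, x.c⟩ := rfl

variable (p) in
/-- The kernel of `quotientAut` consists of the automorphisms `centralAut s t`. -/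
def kerQuotientAutEquiv [NeZero p] : (quotientAut p).ker ≃ ZMod p × ZMod p where
  toFun φ := ((φ.1 ⟨1, 0, 0⟩).b, (φ.1 ⟨0, 0, 1⟩).b)
  invFun s := ⟨centralAut s.1 s.2, mem_ker_quotientAut.2 fun _ => ⟨rfl, rfl⟩⟩
  left_inv φ := by
    have h := mem_ker_quotientAut.1 φ.2
    refine Subtype.ext (mulAut_ext ?_ ?_)
    · ext <;> simp [centralAut_apply, h]
    · ext <;> simp [centralAut_apply, h]
  right_inv s := by simp [centralAut_apply]

lemma card_ker_quotientAut [NeZero p] : Nat.card (quotientAut p).ker = p ^ 2 := by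
  rw [Nat.card_congr (kerQuotientAutEquiv p), Nat.card_prod, Nat.card_zmod, sq]

/-- The endomorphism of the Heisenberg group lifting the matrix `!![α, β; γ, δ]`, for odd `p`. -/
def liftMatrix [Fact p.Prime] (h2 : (2 : ZMod p) ≠ 0) (α β γ δ : ZMod p) :
    Heisenberg p →* Heisenberg p where
  toFun x := ⟨α * x.a + β * x.c,
    (α * δ - β * γ) * x.b + (α * γ * x.a ^ 2 + β * δ * x.c ^ 2) / 2 + β * γ * x.a * x.c,
    γ * x.a + δ * x.c⟩
  map_one' := by ext <;> simp
  map_mul' x y := by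
    ext
    · simp; ring
    · simp; field_simp; ring
    · simp; ring

lemma liftMatrix_injective [Fact p.Prime] (h2 : (2 : ZMod p) ≠ 0) {α β γ δ : ZMod p}
    (hdet : α * δ - β * γ ≠ 0) : Function.Injective (liftMatrix h2 α β γ δ) := by
  rw [injective_iff_map_eq_one]
  intro x hx
  have ha : α * x.a + β * x.c = 0 := congrArg Heisenberg.a hx
  have hb : (α * δ - β * γ) * x.b + (α * γ * x.a ^ 2 + β * δ * x.c ^ 2) / 2 + β * γ * x.a * x.c
    = 0 := congrArg Heisenberg.b hx
  have hc : γ * x.a + δ * x.c = 0 := congrArg Heisenberg.c hx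
  have ha' : x.a = 0 :=
    (mul_eq_zero.1 (by linear_combination δ * ha - β * hc :
      (α * δ - β * γ) * x.a = 0)).resolve_left hdet
  have hc' : x.c = 0 :=
    (mul_eq_zero.1 (by linear_combination α * hc - γ * ha :
      (α * δ - β * γ) * x.c = 0)).resolve_left hdet
  have hb' : x.b = 0 := by simpa [ha', hc', hdet] using hb
  exact Heisenberg.ext ha' hb' hc'

instance [NeZero p] : Finite (Heisenberg p) :=
  Finite.of_injective (fun x => (x.a, x.b, x.c)) fun x y h => by
    simp only [Prod.mk.injEq] at h
    exact Heisenberg.ext h.1 h.2.1 h.2.2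

lemma quotientAut_surjective [Fact p.Prime] (h2 : (2 : ZMod p) ≠ 0) :
    Function.Surjective (quotientAut p) := by
  intro ψ
  obtain ⟨M, rfl⟩ := (quotientAutEquivGL p).symm.surjective ψ
  have hdet : M.val 0 0 * M.val 1 1 - M.val 0 1 * M.val 1 0 ≠ 0 := by
    rw [← Matrix.det_fin_two]
    exact M.det_ne_zero
  refine ⟨MulEquiv.ofBijective _
    (Finite.injective_iff_bijective.1 (liftMatrix_injective h2 hdet)), ?_⟩
  ext x
  induction x using QuotientGroup.induction_on with
  | H x =>
    apply (quotientCenterEquiv p).injective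
    rw [quotientAutEquivGL_symm_apply, quotientAut_mk]
    change Multiplicative.ofAdd ![_, _] = _
    congr 1
    ext i
    fin_cases i <;> simp [liftMatrix, Matrix.mulVec, dotProduct, Fin.sum_univ_two]

lemma card_quotientAut [Fact p.Prime] :
    Nat.card (MulAut (Heisenberg p ⧸ Subgroup.center (Heisenberg p))) =
      p * (p - 1) ^ 2 * (p + 1) := by
  rw [Nat.card_congr (quotientAutEquivGL p), Matrix.card_GL_field]
  simp only [ZMod.card, Fin.prod_univ_two, Fin.val_zero, Fin.val_one, pow_zero, pow_one]
  obtain ⟨q, hq⟩ : ∃ q, p = q + 1 := Nat.exists_eq_add_one.2 (Fact.out : p.Prime).pos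
  have h₁ : p ^ 2 - 1 = q * (p + 1) := by
    rw [hq]; exact Nat.sub_eq_of_eq_add (by ring)
  have h₂ : p ^ 2 - p = q * p := by
    rw [hq]; exact Nat.sub_eq_of_eq_add (by ring)
  rw [h₁, h₂, show p - 1 = q by omega]
  ring

end Heisenberg

/-- For an odd prime `p`, `|Aut(H_p)| = p^3 * (p-1)^2 * (p+1)`; the natural map
`Aut(H_p) → Aut(H_p / Z(H_p))` is surjective with kernel of order `p^2`. -/
theorem stmt_19 (p : ℕ) (hp : p.Prime) (hodd : Odd p) :
    Nat.card (MulAut (Heisenberg p)) = p ^ 3 * (p - 1) ^ 2 * (p + 1) ∧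
    ∃ F : MulAut (Heisenberg p) →*
        MulAut (Heisenberg p ⧸ Subgroup.center (Heisenberg p)),
      (∀ (φ : MulAut (Heisenberg p)) (x : Heisenberg p),
        F φ (QuotientGroup.mk x) = QuotientGroup.mk (φ x)) ∧
      Function.Surjective F ∧ Nat.card ↥F.ker = p ^ 2 := by
  have : Fact p.Prime := ⟨hp⟩
  have h2 : (2 : ZMod p) ≠ 0 := Ring.two_ne_zero (by
    rw [ZMod.ringChar_zmod_n]
    rintro rfl
    exact absurd hodd (by decide))
  have hsurj := Heisenberg.quotientAut_surjective h2
  refine ⟨?_, Heisenberg.quotientAut p, Heisenberg.quotientAut_mk, hsurj,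
    Heisenberg.card_ker_quotientAut⟩
  rw [← (Heisenberg.quotientAut p).ker.card_mul_index, Subgroup.index_ker,
    MonoidHom.range_eq_top.2 hsurj, Subgroup.card_top, Heisenberg.card_ker_quotientAut,
    Heisenberg.card_quotientAut]
  ring
end
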